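/- Let f ∈ ℝ[X₁,…,Xₙ] with deg f ≤ 2d−1 (so in particular deg f ≤ 2d), d ≥ 1, and let y be an optimal solution of the moment relaxation (P_{2d}) (feasible with objective value equal to P*_{2d}). Write M_d(y) in block form [A, B; Bᵀ, C] with A = M_{d-1}(y), choose W with B = AW, and suppose the modified moment matrix M̃ := [A, B; Bᵀ, WᵀAW] is a generalized Hankel matrix. Then P* = P*_{2d}, and there exist r ∈ ℕ, λ₁,…,λ_r > 0 and a₁,…,a_r ∈ ℝⁿ such that M̃ = Σᵢ₌₁ʳ λᵢ V_d(aᵢ)V_d(aᵢ)ᵀ and each aᵢ is a global minimizer of f (f(aᵢ) = P* for all i). -/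

import Mathlib

open MvPolynomial Matrix

noncomputable section

/-- `Idx n d` is the set `N_d` of exponent multi-indices `α ∈ ℕⁿ` with `|α| ≤ d`. -/
abbrev Idx (n d : ℕ) := {α : Fin n →₀ ℕ // (∑ i, α i) ≤ d}

instance idxFintype (n d : ℕ) : Fintype (Idx n d) :=
  Fintype.ofInjective
    (fun a => (fun i => (⟨a.1 i, Nat.lt_succ_of_le
        (le_trans (Finset.single_le_sum (fun _ _ => Nat.zero_le _) (Finset.mem_univ i)) a.2)⟩ :
        Fin (d + 1))))
    (fun a b h => by
      apply Subtype.ext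
      ext i
      exact congrArg Fin.val (congrFun h i))

/-- The moment matrix `M_d(y)`, indexed by `N_d × N_d`, with entries `y_{α+β}`. -/
def momMat (n d : ℕ) (y : (Fin n →₀ ℕ) → ℝ) : Matrix (Idx n d) (Idx n d) ℝ :=
  Matrix.of fun a b => y (a.1 + b.1)

/-- The vector `V_d(x) = (x^α)_{α ∈ N_d}` of monomials of degree at most `d` at `x`. -/
def monoVec (n d : ℕ) (x : Fin n → ℝ) : Idx n d → ℝ :=
  fun a => ∏ i, x i ^ (a.1 i)

/-- The Riesz functional `L_y(h) = Σ_α h_α y_α`. -/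
def riesz {n : ℕ} (y : (Fin n →₀ ℕ) → ℝ) (h : MvPolynomial (Fin n) ℝ) : ℝ :=
  ∑ α ∈ h.support, h.coeff α * y α

/-- Feasibility for the moment relaxation `(P_k)` : `y_0 = 1` and `M_{⌊k/2⌋}(y) ⪰ 0`. -/
def momFeasible (n k : ℕ) (y : (Fin n →₀ ℕ) → ℝ) : Prop :=
  y 0 = 1 ∧ (momMat n (k / 2) y).PosSemidef

/-- `P*_k`, the optimal value of the moment relaxation `(P_k)`. -/
def momOpt (n k : ℕ) (f : MvPolynomial (Fin n) ℝ) : EReal :=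
  sInf {v : EReal | ∃ y, momFeasible n k y ∧ v = (riesz y f : ℝ)}

/-- `P*`, the global infimum of `f` on `ℝⁿ`. -/
def globalOpt (n : ℕ) (f : MvPolynomial (Fin n) ℝ) : EReal :=
  sInf {v : EReal | ∃ x : Fin n → ℝ, v = (eval x f : ℝ)}

/-- `HIdx n d` is the set of exponent multi-indices `α ∈ ℕⁿ` with `|α| = d`. -/
abbrev HIdx (n d : ℕ) := {α : Fin n →₀ ℕ // (∑ i, α i) = d}

instance hIdxFintype (n d : ℕ) : Fintype (HIdx n d) :=
  Fintype.ofInjective (fun a => (⟨a.1, le_of_eq a.2⟩ : Idx n d))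
    (fun a b h => by
      have h' := congrArg (fun z : Idx n d => z.1) h
      exact Subtype.ext h')

/-- The exponent multi-index attached to a block index of `N_d = N_{d-1} ⊔ {|α| = d}`. -/
def bDeg (n d e : ℕ) : Idx n d ⊕ HIdx n e → (Fin n →₀ ℕ) :=
  Sum.elim Subtype.val Subtype.val

theorem flat_ops {E ι : Type*} [NormedAddCommGroup E] [InnerProductSpace ℝ E] [Fintype ι] {n : ℕ}
    (v : ι → E) (hv : Submodule.span ℝ (Set.range v) = ⊤) (w : Fin n → ι → E)
    (h1 : ∀ j a b, inner ℝ (w j a) (v b) = inner ℝ (v a) (w j b))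
    (h2 : ∀ j k a b, inner ℝ (w j a) (w k b) = inner ℝ (w k a) (w j b)) :
    ∃ T : Fin n → E →ₗ[ℝ] E, (∀ j a, T j (v a) = w j a) ∧ (∀ j, (T j).IsSymmetric) ∧
      Pairwise (Function.onFun Commute T) := by
  classical
  set P := Fintype.linearCombination ℝ v with hP
  have hsurj : LinearMap.range P = ⊤ := by rw [hP, Fintype.range_linearCombination, hv]
  obtain ⟨g, hg⟩ := P.exists_rightInverse_of_surjective hsurj
  have hs : Function.Surjective P := LinearMap.range_eq_top.mp hsurj
  have hg' : ∀ x, P (g x) = x := fun x => by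
    simpa using congrArg (fun F => F x) hg
  set S : Fin n → (ι → ℝ) →ₗ[ℝ] E := fun j => Fintype.linearCombination ℝ (w j) with hS
  have k1 : ∀ j c c', inner ℝ (S j c) (P c') = inner ℝ (P c) (S j c') := by
    intro j c c'
    simp only [hS, hP, Fintype.linearCombination_apply, sum_inner, inner_sum, inner_smul_left,
      inner_smul_right, h1]
  have k2 : ∀ j k c c', inner ℝ (S j c) (S k c') = inner ℝ (S k c) (S j c') := by
    intro j k c c'
    simp only [hS, Fintype.linearCombination_apply, sum_inner, inner_sum, inner_smul_left,
      inner_smul_right, h2 j k]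
  have key : ∀ j c, S j (g (P c)) = S j c := by
    intro j c
    refine ext_inner_right ℝ fun x => ?_
    obtain ⟨c', rfl⟩ := hs x
    rw [k1, k1, hg']
  have hTS : ∀ j c, ((S j).comp g) (P c) = S j c := fun j c => key j c
  have hsym : ∀ j, ((S j).comp g).IsSymmetric := by
    intro j x z
    obtain ⟨c, rfl⟩ := hs x
    obtain ⟨c', rfl⟩ := hs z
    rw [hTS, hTS, k1]
  refine ⟨fun j => (S j).comp g, ?_, hsym, ?_⟩
  · intro j a
    have h := hTS j (Pi.single a 1)
    simpa [hP, hS, Fintype.linearCombination_apply_single] using h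
  · intro j k _
    refine LinearMap.ext fun x => ?_
    obtain ⟨c, rfl⟩ := hs x
    refine ext_inner_right ℝ fun z => ?_
    obtain ⟨c', rfl⟩ := hs z
    change inner ℝ (((S j).comp g) (((S k).comp g) (P c))) _ =
      inner ℝ (((S k).comp g) (((S j).comp g) (P c))) _
    rw [hTS, hTS, hsym j, hsym k, hTS, hTS, k2]

theorem flat_atoms {E : Type*} [NormedAddCommGroup E] [InnerProductSpace ℝ E]
    [FiniteDimensional ℝ E] {n d : ℕ} (T : Fin n → E →ₗ[ℝ] E) (hT : ∀ j, (T j).IsSymmetric)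
    (hC : Pairwise (Function.onFun Commute T)) (u : (Fin n →₀ ℕ) → E)
    (hu : ∀ j α, (∑ i, α i) + 1 ≤ d → u (α + Finsupp.single j 1) = T j (u α)) :
    ∃ (s : Finset (Fin n → ℝ)) (g : (Fin n → ℝ) → ℝ), (∀ γ ∈ s, 0 < g γ) ∧
      ∀ α β : Fin n →₀ ℕ, (∑ i, α i) ≤ d → (∑ i, β i) ≤ d →
        inner ℝ (u α) (u β) = ∑ γ ∈ s, g γ * ((∏ j, γ j ^ α j) * ∏ j, γ j ^ β j) := by
  classical
  have htop := LinearMap.IsSymmetric.iSup_iInf_eq_top_of_commute hT hC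
  have hmem : u 0 ∈ ⨆ χ : Fin n → ℝ, ⨅ i, Module.End.eigenspace (T i) (χ i) := by
    rw [htop]; trivial
  obtain ⟨x, hx, hsum⟩ := (Submodule.mem_iSup_iff_exists_finsupp _ _).mp hmem
  have heig : ∀ γ j, T j (x γ) = γ j • x γ := fun γ j =>
    Module.End.mem_eigenspace_iff.mp ((Submodule.mem_iInf _).mp (hx γ) j)
  have horth : ∀ γ δ, γ ≠ δ → inner ℝ (x γ) (x δ) = 0 := fun γ δ h =>
    LinearMap.IsSymmetric.orthogonalFamily_iInf_eigenspaces hT h ⟨x γ, hx γ⟩ ⟨x δ, hx δ⟩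
  have hrep : ∀ m, ∀ α : Fin n →₀ ℕ, (∑ i, α i) = m → m ≤ d →
      u α = ∑ γ ∈ x.support, (∏ j, γ j ^ α j) • x γ := by
    intro m
    induction m with
    | zero =>
      intro α hα _
      have : α = 0 := by
        ext i
        simpa using (Finset.sum_eq_zero_iff.mp hα) i (Finset.mem_univ i)
      subst this
      simp only [Finsupp.coe_zero, Pi.zero_apply, pow_zero, Finset.prod_const_one, one_smul]
      exact hsum.symm
    | succ m ih =>
      intro α hα hm
      obtain ⟨j, hj⟩ : ∃ j, α j ≠ 0 := by
        by_contra! h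
        simp [h] at hα
      have hsp : α - Finsupp.single j 1 + Finsupp.single j 1 = α := by
        apply tsub_add_cancel_of_le
        rw [Finsupp.single_le_iff]; omega
      generalize α - Finsupp.single j 1 = β at hsp
      subst hsp
      have hβ : ∑ i, β i = m := by
        simp only [Finsupp.add_apply, Finset.sum_add_distrib, Finsupp.single_apply,
          Finset.sum_ite_eq, Finset.mem_univ, if_true] at hα
        omega
      rw [hu j β (by omega), ih β hβ (by omega), map_sum]
      refine Finset.sum_congr rfl fun γ _ => ?_
      rw [map_smul, heig, smul_smul]
      congr 1
      simp only [Finsupp.add_apply, pow_add, Finset.prod_mul_distrib]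
      congr 1
      rw [Finset.prod_eq_single j] <;> simp +contextual [eq_comm]
  refine ⟨x.support, fun γ => inner ℝ (x γ) (x γ), ?_, ?_⟩
  · intro γ hγ
    exact real_inner_self_pos.mpr (Finsupp.mem_support_iff.mp hγ)
  · intro α β hα hβ
    rw [hrep _ α rfl hα, hrep _ β rfl hβ, sum_inner]
    refine Finset.sum_congr rfl fun γ hγ => ?_
    rw [inner_sum, Finset.sum_eq_single γ]
    · rw [real_inner_smul_left, real_inner_smul_right]; ring
    · intro δ _ hne
      rw [real_inner_smul_left, real_inner_smul_right, horth _ _ hne.symm]; simp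
    · intro h; exact absurd hγ h

open scoped MatrixOrder Matrix.Norms.L2Operator in
theorem exists_gram {ι : Type*} [Fintype ι] (A : Matrix ι ι ℝ) (hA : A.PosSemidef) :
    ∃ v : ι → EuclideanSpace ℝ ι, ∀ a b, inner ℝ (v a) (v b) = A a b := by
  classical
  obtain ⟨R, hR⟩ := CStarAlgebra.nonneg_iff_eq_star_mul_self.mp hA.nonneg
  refine ⟨fun a => WithLp.toLp 2 (fun k => R k a), fun a b => ?_⟩
  rw [hR]
  simp [PiLp.inner_apply, Matrix.mul_apply, Matrix.star_apply, mul_comm]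

theorem exists_gram_span {ι : Type*} [Fintype ι] (A : Matrix ι ι ℝ) (hA : A.PosSemidef) :
    ∃ (K : Submodule ℝ (EuclideanSpace ℝ ι)) (v : ι → K),
      Submodule.span ℝ (Set.range v) = ⊤ ∧ ∀ a b, inner ℝ (v a) (v b) = A a b := by
  obtain ⟨v0, hv0⟩ := exists_gram A hA
  exact ⟨Submodule.span ℝ (Set.range v0), fun a => ⟨v0 a, Submodule.subset_span ⟨a, rfl⟩⟩,
    (Submodule.span_range_subtype_eq_top_iff (Submodule.span ℝ (Set.range v0))
      (fun a => Submodule.subset_span (Set.mem_range_self a))).mpr rfl, hv0⟩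

theorem flat_rep_aux {K : Type*} [NormedAddCommGroup K] [InnerProductSpace ℝ K]
    [FiniteDimensional ℝ K] (n d : ℕ) (hd : 1 ≤ d) (y : (Fin n →₀ ℕ) → ℝ)
    (v : Idx n (d - 1) → K) (hv : Submodule.span ℝ (Set.range v) = ⊤)
    (hvi : ∀ a b, inner ℝ (v a) (v b) = momMat n (d - 1) y a b)
    (B : Matrix (Idx n (d - 1)) (HIdx n d) ℝ)
    (W : Matrix (Idx n (d - 1)) (HIdx n d) ℝ) (hW : B = momMat n (d - 1) y * W)
    (Mt : Matrix (Idx n (d - 1) ⊕ HIdx n d) (Idx n (d - 1) ⊕ HIdx n d) ℝ)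
    (hMt : Mt = Matrix.fromBlocks (momMat n (d - 1) y) B Bᵀ (Wᵀ * momMat n (d - 1) y * W))
    (hHankel : ∀ a b a' b' : Idx n (d - 1) ⊕ HIdx n d,
      bDeg n (d - 1) d a + bDeg n (d - 1) d b = bDeg n (d - 1) d a' + bDeg n (d - 1) d b' →
      Mt a b = Mt a' b') :
    ∃ (s : Finset (Fin n → ℝ)) (g : (Fin n → ℝ) → ℝ), (∀ γ ∈ s, 0 < g γ) ∧
      ∀ a b, Mt a b = ∑ γ ∈ s, g γ * ((∏ j, γ j ^ (bDeg n (d - 1) d a) j) *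
        ∏ j, γ j ^ (bDeg n (d - 1) d b) j) := by
  classical
  set A := momMat n (d - 1) y with hAdef
  let w : Idx n (d - 1) → HIdx n d → ℝ := fun c b => W c b
  let U : Idx n (d - 1) ⊕ HIdx n d → K := Sum.elim v (fun b => ∑ c, w c b • v c)
  have hU : ∀ a b, inner ℝ (U a) (U b) = Mt a b := by
    have hAB : ∀ a b, inner ℝ (v a) (∑ c, w c b • v c) = B a b := by
      intro a b
      rw [inner_sum, hW, Matrix.mul_apply]
      refine Finset.sum_congr rfl fun c _ => ?_
      rw [real_inner_smul_right, hvi]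
      exact mul_comm _ _
    rintro (a | a) (b | b)
    · rw [hMt]; exact hvi a b
    · rw [hMt]; exact hAB a b
    · rw [hMt, real_inner_comm]; exact hAB b a
    · rw [hMt]
      simp only [U, Sum.elim_inr, Matrix.fromBlocks_apply₂₂, Matrix.mul_assoc, ← hW]
      rw [sum_inner, Matrix.mul_apply]
      refine Finset.sum_congr rfl fun c _ => ?_
      rw [real_inner_smul_left, hAB, Matrix.transpose_apply]
  let u : (Fin n →₀ ℕ) → K := fun α =>
    if h : (∑ i, α i) ≤ d - 1 then U (Sum.inl ⟨α, h⟩)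
    else if h' : (∑ i, α i) = d then U (Sum.inr ⟨α, h'⟩) else 0
  have huU : ∀ a, u (bDeg n (d - 1) d a) = U a := by
    rintro (a | a)
    · have := a.2
      simp [u, bDeg, this]
    · have := a.2
      have h2 : ¬ (∑ i, a.1 i) ≤ d - 1 := by omega
      simp only [u, bDeg, Sum.elim_inr, dif_neg h2, dif_pos this]
  have hex : ∀ α : Fin n →₀ ℕ, (∑ i, α i) ≤ d → ∃ a, bDeg n (d - 1) d a = α := by
    intro α hα
    by_cases h : (∑ i, α i) ≤ d - 1
    · exact ⟨Sum.inl ⟨α, h⟩, rfl⟩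
    · exact ⟨Sum.inr ⟨α, by omega⟩, rfl⟩
  have hH : ∀ α β α' β' : Fin n →₀ ℕ, (∑ i, α i) ≤ d → (∑ i, β i) ≤ d → (∑ i, α' i) ≤ d →
      (∑ i, β' i) ≤ d → α + β = α' + β' → inner ℝ (u α) (u β) = inner ℝ (u α') (u β') := by
    intro α β α' β' h1 h2 h3 h4 h
    obtain ⟨a, rfl⟩ := hex α h1
    obtain ⟨b, rfl⟩ := hex β h2
    obtain ⟨a', rfl⟩ := hex α' h3
    obtain ⟨b', rfl⟩ := hex β' h4
    rw [huU, huU, huU, huU, hU, hU]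
    exact hHankel _ _ _ _ h
  have hsum1 : ∀ (α : Fin n →₀ ℕ) j, ∑ i, (α + Finsupp.single j 1 : Fin n →₀ ℕ) i = (∑ i, α i) + 1 := by
    intro α j
    simp [Finset.sum_add_distrib, Finsupp.single_apply]
  have hvu : ∀ a : Idx n (d - 1), v a = u a.1 := fun a => (huU (Sum.inl a)).symm
  obtain ⟨T, hTv, hTs, hTc⟩ := flat_ops v hv (fun (j : Fin n) a => u (a.1 + Finsupp.single j 1))
    (by
      intro j a b
      have ha := a.2
      have hb := b.2
      rw [hvu, hvu]
      apply hH <;> try simp only [hsum1]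
      · omega
      · omega
      · omega
      · omega
      · abel)
    (by
      intro j k a b
      have ha := a.2
      have hb := b.2
      apply hH <;> try simp only [hsum1]
      · omega
      · omega
      · omega
      · omega
      · abel)
  obtain ⟨s, g, hg, hrep⟩ := flat_atoms (d := d) T hTs hTc u (by
    intro j α hα
    have h := hTv j ⟨α, by omega⟩
    rw [hvu] at h
    exact h.symm)
  refine ⟨s, g, hg, fun a b => ?_⟩
  have hle : ∀ a, ∑ i, (bDeg n (d - 1) d a) i ≤ d := by
    rintro (a | a)
    · have := a.2
      simp only [bDeg, Sum.elim_inl]; omega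
    · exact a.2.le
  rw [← hU, ← huU, ← huU, hrep _ _ (hle a) (hle b)]

theorem flat_rep (n d : ℕ) (hd : 1 ≤ d) (y : (Fin n →₀ ℕ) → ℝ)
    (hA : (momMat n (d - 1) y).PosSemidef)
    (B : Matrix (Idx n (d - 1)) (HIdx n d) ℝ)
    (W : Matrix (Idx n (d - 1)) (HIdx n d) ℝ) (hW : B = momMat n (d - 1) y * W)
    (Mt : Matrix (Idx n (d - 1) ⊕ HIdx n d) (Idx n (d - 1) ⊕ HIdx n d) ℝ)
    (hMt : Mt = Matrix.fromBlocks (momMat n (d - 1) y) B Bᵀ (Wᵀ * momMat n (d - 1) y * W))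
    (hHankel : ∀ a b a' b' : Idx n (d - 1) ⊕ HIdx n d,
      bDeg n (d - 1) d a + bDeg n (d - 1) d b = bDeg n (d - 1) d a' + bDeg n (d - 1) d b' →
      Mt a b = Mt a' b') :
    ∃ (s : Finset (Fin n → ℝ)) (g : (Fin n → ℝ) → ℝ), (∀ γ ∈ s, 0 < g γ) ∧
      ∀ a b, Mt a b = ∑ γ ∈ s, g γ * ((∏ j, γ j ^ (bDeg n (d - 1) d a) j) *
        ∏ j, γ j ^ (bDeg n (d - 1) d b) j) := by
  obtain ⟨K, v, hv, hvi⟩ := exists_gram_span _ hA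
  exact flat_rep_aux n d hd y v hv hvi B W hW Mt hMt hHankel

theorem exists_split {n : ℕ} : ∀ (m : ℕ) (α : Fin n →₀ ℕ), m ≤ ∑ i, α i →
    ∃ β γ : Fin n →₀ ℕ, β + γ = α ∧ ∑ i, β i = m := by
  intro m
  induction m with
  | zero => intro α _; exact ⟨0, α, by simp, by simp⟩
  | succ m ih =>
    intro α h
    obtain ⟨β, γ, rfl, hβ⟩ := ih α (by omega)
    obtain ⟨j, hj⟩ : ∃ j, γ j ≠ 0 := by
      by_contra! h0
      simp [h0, hβ] at h
    have hsp : Finsupp.single j 1 + (γ - Finsupp.single j 1) = γ := by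
      apply add_tsub_cancel_of_le
      rw [Finsupp.single_le_iff]; omega
    refine ⟨β + Finsupp.single j 1, γ - Finsupp.single j 1, ?_, ?_⟩
    · rw [add_assoc, hsp]
    · simp [Finset.sum_add_distrib, Finsupp.single_apply, hβ]

/-- Every point evaluation is feasible, so the relaxation is a lower bound. -/
theorem momOpt_le_eval (n k : ℕ) (f : MvPolynomial (Fin n) ℝ) (x : Fin n → ℝ) :
    momOpt n k f ≤ ((eval x f : ℝ) : EReal) := by
  refine sInf_le ⟨fun α => ∏ i, x i ^ α i, ⟨by simp, ?_⟩, ?_⟩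
  · have : momMat n (k / 2) (fun α => ∏ i, x i ^ α i) =
        Matrix.vecMulVec (monoVec n (k / 2) x) (star (monoVec n (k / 2) x)) := by
      ext a b
      simp [momMat, monoVec, Matrix.vecMulVec_apply, pow_add, Finset.prod_mul_distrib]
    rw [this]
    exact Matrix.posSemidef_vecMulVec_self_star _
  · rw [riesz, MvPolynomial.eval_eq']

/-- let `deg f ≤ 2d−1` and let `y` be an optimal solution of `(P_{2d})`.
Write `M_d(y)` in block form `[A, B; Bᵀ, C]` with `A = M_{d-1}(y)` (blocks indexed by
`N_d = N_{d-1} ⊔ {|α| = d}`), choose `W` with `B = AW`, and suppose the modified moment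
matrix `M̃ := [A, B; Bᵀ, WᵀAW]` is a generalized Hankel matrix.  Then `P* = P*_{2d}` and
`M̃ = Σᵢ λᵢ V_d(aᵢ)V_d(aᵢ)ᵀ` with `λᵢ > 0`, where every `aᵢ` is a global minimizer of `f`. -/
theorem optimality_from_hankel_modified_matrix (n d : ℕ) (hd : 1 ≤ d)
    (f : MvPolynomial (Fin n) ℝ) (hf : f.totalDegree ≤ 2 * d - 1)
    (y : (Fin n →₀ ℕ) → ℝ) (hfeas : momFeasible n (2 * d) y)
    (hopt : ((riesz y f : ℝ) : EReal) = momOpt n (2 * d) f)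
    (B : Matrix (Idx n (d - 1)) (HIdx n d) ℝ)
    (hB : B = Matrix.of fun a b => y (a.1 + b.1))
    (W : Matrix (Idx n (d - 1)) (HIdx n d) ℝ) (hW : B = momMat n (d - 1) y * W)
    (Mt : Matrix (Idx n (d - 1) ⊕ HIdx n d) (Idx n (d - 1) ⊕ HIdx n d) ℝ)
    (hMt : Mt = Matrix.fromBlocks (momMat n (d - 1) y) B Bᵀ (Wᵀ * momMat n (d - 1) y * W))
    (hHankel : ∀ a b a' b' : Idx n (d - 1) ⊕ HIdx n d,
      bDeg n (d - 1) d a + bDeg n (d - 1) d b = bDeg n (d - 1) d a' + bDeg n (d - 1) d b' →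
      Mt a b = Mt a' b') :
    globalOpt n f = momOpt n (2 * d) f ∧
    ∃ (r : ℕ) (lam : Fin r → ℝ) (a : Fin r → (Fin n → ℝ)),
      (∀ i, 0 < lam i) ∧
      Mt = ∑ i, lam i • Matrix.vecMulVec
          (fun b => ∏ j, a i j ^ (bDeg n (d - 1) d b) j)
          (fun b => ∏ j, a i j ^ (bDeg n (d - 1) d b) j) ∧
      ∀ i, ((eval (a i) f : ℝ) : EReal) = globalOpt n f := by
  classical
  have hdd : 2 * d / 2 = d := by omega
  obtain ⟨hy0, hpsd⟩ := hfeas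
  rw [hdd] at hpsd
  have hA : (momMat n (d - 1) y).PosSemidef :=
    hpsd.submatrix (fun a : Idx n (d - 1) => (⟨a.1, a.2.trans (by omega)⟩ : Idx n d))
  obtain ⟨s, g, hg, hrep⟩ := flat_rep n d hd y hA B W hW Mt hMt hHankel
  -- moments of degree at most 2d-1
  have hmom : ∀ α : Fin n →₀ ℕ, (∑ i, α i) ≤ 2 * d - 1 →
      y α = ∑ γ ∈ s, g γ * ∏ j, γ j ^ α j := by
    intro α hα
    by_cases h : (∑ i, α i) ≤ d - 1
    · have := hrep (Sum.inl ⟨α, h⟩) (Sum.inl ⟨0, by simp⟩)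
      rw [hMt] at this
      simpa [momMat, bDeg] using this
    · obtain ⟨β, γ, rfl, hβ⟩ := exists_split d α (by omega)
      have hγ : ∑ i, γ i ≤ d - 1 := by
        simp only [Finsupp.add_apply, Finset.sum_add_distrib] at hα
        omega
      have := hrep (Sum.inl ⟨γ, hγ⟩) (Sum.inr ⟨β, hβ⟩)
      rw [hMt, Matrix.fromBlocks_apply₁₂, hB] at this
      simp only [Matrix.of_apply, bDeg, Sum.elim_inl, Sum.elim_inr] at this
      rw [add_comm β γ, this]
      simp only [Finsupp.add_apply, pow_add, Finset.prod_mul_distrib]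
  have hg1 : ∑ γ ∈ s, g γ = 1 := by
    have := hmom 0 (by simp)
    rw [hy0] at this
    simpa using this.symm
  have hL : riesz y f = ∑ γ ∈ s, g γ * eval γ f := by
    simp only [riesz, MvPolynomial.eval_eq', Finset.mul_sum]
    rw [Finset.sum_comm]
    refine Finset.sum_congr rfl fun α hα => ?_
    have hdeg : (∑ i, α i) ≤ 2 * d - 1 := by
      have h1 := (MvPolynomial.le_totalDegree hα).trans hf
      rwa [Finsupp.sum_fintype _ _ (fun _ => rfl)] at h1
    rw [hmom α hdeg, Finset.mul_sum]
    refine Finset.sum_congr rfl fun γ _ => ?_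
    ring
  have hlow : ∀ x, riesz y f ≤ eval x f := by
    intro x
    have := momOpt_le_eval n (2 * d) f x
    rw [← hopt] at this
    exact_mod_cast this
  have hmin : ∀ γ ∈ s, eval γ f = riesz y f := by
    have hz : ∑ γ ∈ s, g γ * (eval γ f - riesz y f) = 0 := by
      simp only [mul_sub, Finset.sum_sub_distrib, ← Finset.sum_mul, hg1, ← hL]
      ring
    have h0 := (Finset.sum_eq_zero_iff_of_nonneg (fun γ hγ =>
      mul_nonneg (hg γ hγ).le (sub_nonneg.mpr (hlow γ)))).mp hz
    intro γ hγ
    rcases mul_eq_zero.mp (h0 γ hγ) with h | h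
    · exact absurd h (hg γ hγ).ne'
    · linarith
  have hglob : globalOpt n f = ((riesz y f : ℝ) : EReal) := by
    apply le_antisymm
    · obtain ⟨γ, hγ⟩ : s.Nonempty := by
        rw [Finset.nonempty_iff_ne_empty]
        rintro rfl
        simp at hg1
      exact sInf_le ⟨γ, by rw [hmin γ hγ]⟩
    · refine le_sInf ?_
      rintro _ ⟨x, rfl⟩
      exact_mod_cast hlow x
  refine ⟨hglob.trans hopt, s.card, fun i => g (s.equivFin.symm i).1,
    fun i => (s.equivFin.symm i).1, fun i => hg _ (s.equivFin.symm i).2, ?_, ?_⟩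
  · ext a b
    rw [hrep a b, Matrix.sum_apply, ← Finset.sum_coe_sort s, ← s.equivFin.symm.sum_comp]
    refine Finset.sum_congr rfl fun i _ => ?_
    simp [Matrix.vecMulVec_apply]
  · intro i
    rw [hglob, hmin _ (s.equivFin.symm i).2]
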